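/- Let R be a commutative Noetherian local ring of Krull dimension d, C a semidualizing R-module, and M a maximal Cohen-Macaulay finitely generated R-module such that Hom_R(M,M) has finite C-injective dimension. If Ext_R^i(M,M) = 0 for all 1 ≤ i ≤ d−1, then R is Cohen-Macaulay and C is a canonical module for R (i.e., C has finite injective dimension). -/

import Mathlib

open CategoryTheory

noncomputable section

/-- The `i`-th Ext module of two `R`-modules. -/
def extMod (R : Type) [CommRing R] (i : ℕ) (M N : Type) [AddCommGroup M] [Module R M]
    [AddCommGroup N] [Module R N] : ModuleCat R :=
  ((Ext R (ModuleCat R) i).obj (Opposite.op (ModuleCat.of R M))).obj (ModuleCat.of R N)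

/-- The `i`-th Tor module of two `R`-modules. -/
def torMod (R : Type) [CommRing R] (i : ℕ) (M N : Type) [AddCommGroup M] [Module R M]
    [AddCommGroup N] [Module R N] : ModuleCat R :=
  ((Tor (ModuleCat R) i).obj (ModuleCat.of R M)).obj (ModuleCat.of R N)

/-- The depth of a module over a local ring: the infimum of the set of
indices `i` with `Ext^i(R/𝔪, N) ≠ 0`. -/
def moduleDepth (R : Type) [CommRing R] [IsLocalRing R] (N : Type) [AddCommGroup N]
    [Module R N] : ℕ :=
  sInf {i : ℕ | ¬ Subsingleton (extMod R i (R ⧸ IsLocalRing.maximalIdeal R) N)}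

/-- An `R`-module `N` has finite injective dimension iff there is an `n` such that
`Ext^i(M, N) = 0` for all modules `M` and all `i > n`. -/
def HasFiniteInjDim (R : Type) [CommRing R] (N : Type) [AddCommGroup N] [Module R N] : Prop :=
  ∃ n : ℕ, ∀ (M : Type) [AddCommGroup M] [Module R M], ∀ i : ℕ, n < i →
    Subsingleton (extMod R i M N)

/-- An `R`-module `M` has finite projective dimension iff there is an `n` such that
`Ext^i(M, N) = 0` for all modules `N` and all `i > n`. -/
def HasFiniteProjDim (R : Type) [CommRing R] (M : Type) [AddCommGroup M] [Module R M] : Prop :=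
  ∃ n : ℕ, ∀ (N : Type) [AddCommGroup N] [Module R N], ∀ i : ℕ, n < i →
    Subsingleton (extMod R i M N)

/-- The `𝔪`-torsion submodule `Γ_𝔪(M)` of a module over a local ring. -/
def mTorsion (R : Type) [CommRing R] [IsLocalRing R] (M : Type) [AddCommGroup M]
    [Module R M] : Submodule R M :=
  ⨆ n : ℕ, Submodule.torsionBySet R M ((IsLocalRing.maximalIdeal R ^ n : Ideal R) : Set R)

/-- A semidualizing module: the natural map `R → Hom(C,C)` is bijective and
`Ext^i(C,C) = 0` for all `i ≥ 1`. -/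
structure IsSemidualizing (R : Type) [CommRing R] (C : Type) [AddCommGroup C]
    [Module R C] : Prop where
  bijective : Function.Bijective (LinearMap.lsmul R C)
  ext_vanish : ∀ i : ℕ, 1 ≤ i → Subsingleton (extMod R i C C)

/-- Membership in the Auslander class `A_C(R)`: the natural map `M → Hom(C, C ⊗ M)` is
bijective, `Tor_i(C, M) = 0` and `Ext^i(C, C ⊗ M) = 0` for all `i ≥ 1`. -/
structure MemAuslanderClass (R : Type) [CommRing R] (C : Type) [AddCommGroup C] [Module R C]
    (M : Type) [AddCommGroup M] [Module R M] : Prop where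
  bijective : Function.Bijective ((TensorProduct.mk R C M).flip)
  tor_vanish : ∀ i : ℕ, 1 ≤ i → Subsingleton (torMod R i C M)
  ext_vanish : ∀ i : ℕ, 1 ≤ i → Subsingleton (extMod R i C (TensorProduct R C M))

/-- A module `N` is Tor-rigid if for every finitely generated module `M` and every `i ≥ 1`,
`Tor_i(M, N) = 0` implies `Tor_{i+1}(M, N) = 0`. -/
def IsTorRigid (R : Type) [CommRing R] (N : Type) [AddCommGroup N] [Module R N] : Prop :=
  ∀ (M : Type) [AddCommGroup M] [Module R M], Module.Finite R M →
    ∀ i : ℕ, 1 ≤ i → Subsingleton (torMod R i M N) → Subsingleton (torMod R (i + 1) M N)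

/-- The natural map `C ⊗ Hom(M,N) → Hom(M, C ⊗ N)`, sending `c ⊗ φ` to `m ↦ c ⊗ φ m`. -/
def homTensorMap (R : Type) [CommRing R] (C M N : Type) [AddCommGroup C] [Module R C]
    [AddCommGroup M] [Module R M] [AddCommGroup N] [Module R N] :
    TensorProduct R C (M →ₗ[R] N) →ₗ[R] (M →ₗ[R] TensorProduct R C N) :=
  TensorProduct.lift
    ((LinearMap.llcomp R M N (TensorProduct R C N)).comp (TensorProduct.mk R C N))

section Bridge
variable {R : Type} [CommRing R] (M N : Type) [AddCommGroup M] [Module R M]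
    [AddCommGroup N] [Module R N]

theorem subsingleton_extMod_succ_iff (i : ℕ) :
    Subsingleton (extMod R (i + 1) M N) ↔
      Subsingleton (Abelian.Ext (ModuleCat.of R M) (ModuleCat.of R N) (i + 1)) := by
  let P := ProjectiveResolution.of (ModuleCat.of R M)
  have h1 : Subsingleton (extMod R (i + 1) M N) ↔
      (P.complex.linearYonedaObj R (ModuleCat.of R N)).ExactAt (i + 1) := by
    rw [HomologicalComplex.exactAt_iff_isZero_homology, ← (P.isoExt (i + 1) _).isZero_iff,
      ModuleCat.isZero_iff_subsingleton]
    rfl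
  rw [h1, HomologicalComplex.exactAt_iff' _ i (i + 1) (i + 2) (by simp) (by simp),
    ShortComplex.moduleCat_exact_iff]
  constructor
  · intro h
    refine subsingleton_of_forall_eq 0 fun α => ?_
    obtain ⟨f, hf, rfl⟩ := P.extMk_surjective α (i + 2) rfl
    rw [P.extMk_eq_zero_iff f _ _ hf i rfl]
    exact h f hf
  · intro h f hf
    exact (P.extMk_eq_zero_iff f (i + 2) rfl hf i rfl).1 (Subsingleton.elim _ _)

theorem subsingleton_extMod_zero_iff :
    Subsingleton (extMod R 0 M N) ↔
      Subsingleton (Abelian.Ext (ModuleCat.of R M) (ModuleCat.of R N) 0) := by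
  let P := ProjectiveResolution.of (ModuleCat.of R M)
  have h1 : Subsingleton (extMod R 0 M N) ↔
      (P.complex.linearYonedaObj R (ModuleCat.of R N)).ExactAt 0 := by
    rw [HomologicalComplex.exactAt_iff_isZero_homology, ← (P.isoExt 0 _).isZero_iff,
      ModuleCat.isZero_iff_subsingleton]
    rfl
  rw [h1, HomologicalComplex.exactAt_iff' _ 0 0 1 (by simp) (by simp),
    ShortComplex.moduleCat_exact_iff, Abelian.Ext.homEquiv₀.subsingleton_congr]
  constructor
  · intro h
    refine subsingleton_of_forall_eq 0 fun α => ?_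
    let π : P.complex.X 0 ⟶ ModuleCat.of R M := P.π.f 0
    have hπ : P.complex.d 1 0 ≫ π = 0 := P.complex_d_comp_π_f_zero
    have hz : π ≫ α = 0 := by
      obtain ⟨x, hx⟩ := h (π ≫ α) (by
        change P.complex.d 1 0 ≫ π ≫ α = 0
        rw [← Category.assoc, hπ, Limits.zero_comp])
      rw [← hx]
      have h0 (y : P.complex.X 0 ⟶ ModuleCat.of R N) : P.complex.d 0 0 ≫ y = 0 := by
        rw [P.complex.shape 0 0 (by simp), Limits.zero_comp]
      exact h0 x
    have : Epi π := inferInstanceAs (Epi (P.π.f 0))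
    exact (cancel_epi π).1 (hz.trans Limits.comp_zero.symm)
  · intro h f hf
    obtain ⟨g, hg⟩ := Limits.CokernelCofork.IsColimit.desc' P.isColimitCokernelCofork f hf
    have hg0 : g = 0 := h.elim (α := ModuleCat.of R M ⟶ ModuleCat.of R N) g 0
    refine ⟨0, ?_⟩
    rw [map_zero, ← hg, hg0]
    exact Limits.comp_zero.symm
end Bridge

section ExtVanish

open TensorProduct

variable {R : Type} [CommRing R]

/-- `Ext^i(A, B) = 0`. -/
def ExtVanish (R : Type) [CommRing R] (i : ℕ) (A B : Type) [AddCommGroup A] [Module R A]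
    [AddCommGroup B] [Module R B] : Prop :=
  Subsingleton (Abelian.Ext (ModuleCat.of R A) (ModuleCat.of R B) i)

variable {A B D X Y : Type} [AddCommGroup A] [Module R A] [AddCommGroup B] [Module R B]
  [AddCommGroup D] [Module R D] [AddCommGroup X] [Module R X] [AddCommGroup Y] [Module R Y]

theorem subsingleton_extMod_iff (i : ℕ) :
    Subsingleton (extMod R i A B) ↔ ExtVanish R i A B := by
  cases i with
  | zero => exact subsingleton_extMod_zero_iff A B
  | succ i => exact subsingleton_extMod_succ_iff A B i

theorem extVanish_zero_iff : ExtVanish R 0 A B ↔ Subsingleton (A →ₗ[R] B) :=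
  (Abelian.Ext.addEquiv₀.trans ModuleCat.homAddEquiv).toEquiv.subsingleton_congr

theorem extVanish_of_projective [Module.Projective R A] (i : ℕ) : ExtVanish R (i + 1) A B := by
  have : Projective (ModuleCat.of R A) := (IsProjective.iff_projective A).1 inferInstance
  exact subsingleton_of_forall_eq 0 fun x => x.eq_zero_of_projective

/-- The short complex of `R`-modules attached to a short exact sequence of linear maps. -/
abbrev exactComplex (f : A →ₗ[R] B) (g : B →ₗ[R] D) (h : Function.Exact f g) :
    ShortComplex (ModuleCat R) :=
  ShortComplex.mk (ModuleCat.ofHom f) (ModuleCat.ofHom g)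
    (by rw [← ModuleCat.ofHom_comp, h.linearMap_comp_eq_zero]; rfl)

variable {f : A →ₗ[R] B} {g : B →ₗ[R] D}

theorem exactComplex_shortExact (hf : Function.Injective f) (h : Function.Exact f g)
    (hg : Function.Surjective g) : (exactComplex f g h).ShortExact :=
  ModuleCat.shortComplex_shortExact _ h hf hg

theorem ExtVanish.cov_mid (hf : Function.Injective f) (h : Function.Exact f g)
    (hg : Function.Surjective g) {i : ℕ} (hA : ExtVanish R i X A) (hD : ExtVanish R i X D) :
    ExtVanish R i X B := by
  have hS := exactComplex_shortExact hf h hg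
  refine subsingleton_of_forall_eq 0 fun x => ?_
  obtain ⟨y, rfl⟩ := Abelian.Ext.covariant_sequence_exact₂ _ hS x (hD.elim _ _)
  rw [hA.elim y 0, Abelian.Ext.zero_comp]

theorem ExtVanish.cov_left (hf : Function.Injective f) (h : Function.Exact f g)
    (hg : Function.Surjective g) {i : ℕ} (hD : ExtVanish R i X D)
    (hB : ExtVanish R (i + 1) X B) : ExtVanish R (i + 1) X A := by
  have hS := exactComplex_shortExact hf h hg
  refine subsingleton_of_forall_eq 0 fun x => ?_
  obtain ⟨y, rfl⟩ := Abelian.Ext.covariant_sequence_exact₁ _ hS x (hB.elim _ _) rfl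
  rw [hD.elim y 0, Abelian.Ext.zero_comp]

theorem ExtVanish.cov_right (hf : Function.Injective f) (h : Function.Exact f g)
    (hg : Function.Surjective g) {i : ℕ} (hB : ExtVanish R i X B)
    (hA : ExtVanish R (i + 1) X A) : ExtVanish R i X D := by
  have hS := exactComplex_shortExact hf h hg
  refine subsingleton_of_forall_eq 0 fun x => ?_
  obtain ⟨y, rfl⟩ := Abelian.Ext.covariant_sequence_exact₃ _ hS x rfl (hA.elim _ _)
  rw [hB.elim y 0, Abelian.Ext.zero_comp]

theorem ExtVanish.contra_mid (hf : Function.Injective f) (h : Function.Exact f g)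
    (hg : Function.Surjective g) {i : ℕ} (hA : ExtVanish R i A Y) (hD : ExtVanish R i D Y) :
    ExtVanish R i B Y := by
  have hS := exactComplex_shortExact hf h hg
  refine subsingleton_of_forall_eq 0 fun x => ?_
  obtain ⟨y, rfl⟩ := Abelian.Ext.contravariant_sequence_exact₂ hS _ x (hA.elim _ _)
  rw [hD.elim y 0, Abelian.Ext.comp_zero]

theorem ExtVanish.contra_right (hf : Function.Injective f) (h : Function.Exact f g)
    (hg : Function.Surjective g) {i : ℕ} (hA : ExtVanish R i A Y)
    (hB : ExtVanish R (i + 1) B Y) : ExtVanish R (i + 1) D Y := by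
  have hS := exactComplex_shortExact hf h hg
  refine subsingleton_of_forall_eq 0 fun x => ?_
  obtain ⟨y, rfl⟩ := Abelian.Ext.contravariant_sequence_exact₃ hS _ x (hB.elim _ _)
    (add_comm 1 i)
  rw [hA.elim y 0, Abelian.Ext.comp_zero]

theorem ExtVanish.contra_left (hf : Function.Injective f) (h : Function.Exact f g)
    (hg : Function.Surjective g) {i : ℕ} (hB : ExtVanish R i B Y)
    (hD : ExtVanish R (i + 1) D Y) : ExtVanish R i A Y := by
  have hS := exactComplex_shortExact hf h hg
  refine subsingleton_of_forall_eq 0 fun x => ?_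
  obtain ⟨y, rfl⟩ := Abelian.Ext.contravariant_sequence_exact₁ hS _ x (add_comm 1 i)
    (hD.elim _ _)
  rw [hB.elim y 0, Abelian.Ext.comp_zero]

theorem ExtVanish.of_retract_right {i : ℕ} (h : ExtVanish R i X B) (s : A →ₗ[R] B)
    (r : B →ₗ[R] A) (hrs : r ∘ₗ s = LinearMap.id) : ExtVanish R i X A := by
  refine subsingleton_of_forall_eq 0 fun x => ?_
  have hx : x.comp (Abelian.Ext.mk₀ (ModuleCat.ofHom s)) (add_zero i) = 0 := h.elim _ _
  rw [← x.comp_mk₀_id, ← ModuleCat.ofHom_id, ← hrs, ModuleCat.ofHom_comp,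
    ← Abelian.Ext.mk₀_comp_mk₀, ← Abelian.Ext.comp_assoc_of_second_deg_zero, hx,
    Abelian.Ext.zero_comp]

theorem ExtVanish.congr_right {i : ℕ} (h : ExtVanish R i X B) (e : A ≃ₗ[R] B) :
    ExtVanish R i X A :=
  h.of_retract_right e.toLinearMap e.symm.toLinearMap (by ext; simp)

theorem ExtVanish.of_retract_left {i : ℕ} (h : ExtVanish R i B Y) (s : A →ₗ[R] B)
    (r : B →ₗ[R] A) (hrs : r ∘ₗ s = LinearMap.id) : ExtVanish R i A Y := by
  refine subsingleton_of_forall_eq 0 fun x => ?_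
  have hx : (Abelian.Ext.mk₀ (ModuleCat.ofHom r)).comp x (zero_add i) = 0 := h.elim _ _
  rw [← x.mk₀_id_comp, ← ModuleCat.ofHom_id, ← hrs, ModuleCat.ofHom_comp,
    ← Abelian.Ext.mk₀_comp_mk₀, Abelian.Ext.comp_assoc_of_second_deg_zero, hx,
    Abelian.Ext.comp_zero]

theorem ExtVanish.congr_left {i : ℕ} (h : ExtVanish R i B Y) (e : A ≃ₗ[R] B) :
    ExtVanish R i A Y :=
  h.of_retract_left e.toLinearMap e.symm.toLinearMap (by ext; simp)

/-- `Ext^1(X, A) = 0` makes `Hom(X, -)` right exact on a short exact sequence. -/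
theorem ExtVanish.exists_lift (hf : Function.Injective f) (h : Function.Exact f g)
    (hg : Function.Surjective g) (hA : ExtVanish R 1 X A) (φ : X →ₗ[R] D) :
    ∃ ψ : X →ₗ[R] B, g ∘ₗ ψ = φ := by
  have hS := exactComplex_shortExact hf h hg
  obtain ⟨y, hy⟩ := Abelian.Ext.covariant_sequence_exact₃ (ModuleCat.of R X) hS
    (Abelian.Ext.mk₀ (ModuleCat.ofHom φ)) (zero_add 1) (hA.elim _ _)
  obtain ⟨ψ, rfl⟩ := Abelian.Ext.homEquiv₀.symm.surjective y
  refine ⟨ψ.hom, ?_⟩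
  rw [Abelian.Ext.homEquiv₀_symm_apply, Abelian.Ext.mk₀_comp_mk₀] at hy
  exact congrArg ModuleCat.Hom.hom (Abelian.Ext.homEquiv₀.symm.injective hy)

/-- `Ext^1(D, Y) = 0` lets homomorphisms be extended along `A → B` with cokernel `D`. -/
theorem ExtVanish.exists_extension (hf : Function.Injective f) (h : Function.Exact f g)
    (hg : Function.Surjective g) (hD : ExtVanish R 1 D Y) (φ : A →ₗ[R] Y) :
    ∃ ψ : B →ₗ[R] Y, ψ ∘ₗ f = φ := by
  have hS := exactComplex_shortExact hf h hg
  obtain ⟨y, hy⟩ := Abelian.Ext.contravariant_sequence_exact₁ hS (ModuleCat.of R Y)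
    (Abelian.Ext.mk₀ (ModuleCat.ofHom φ)) (add_zero 1) (hD.elim _ _)
  obtain ⟨ψ, rfl⟩ := Abelian.Ext.homEquiv₀.symm.surjective y
  refine ⟨ψ.hom, ?_⟩
  rw [Abelian.Ext.homEquiv₀_symm_apply, Abelian.Ext.mk₀_comp_mk₀] at hy
  exact congrArg ModuleCat.Hom.hom (Abelian.Ext.homEquiv₀.symm.injective hy)

theorem ext_comp_lsmul {i : ℕ} (x : Abelian.Ext (ModuleCat.of R X) (ModuleCat.of R A) i) (y : R) :
    x.comp (Abelian.Ext.mk₀ (ModuleCat.ofHom (LinearMap.lsmul R A y))) (add_zero i) = y • x := by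
  rw [Abelian.Ext.smul_eq_comp_mk₀]
  rfl

theorem ext_lsmul_comp {i : ℕ} (x : Abelian.Ext (ModuleCat.of R A) (ModuleCat.of R X) i) (y : R) :
    (Abelian.Ext.mk₀ (ModuleCat.ofHom (LinearMap.lsmul R A y))).comp x (zero_add i) = y • x := by
  have : ModuleCat.ofHom (LinearMap.lsmul R A y) = y • 𝟙 (ModuleCat.of R A) := rfl
  rw [this, Abelian.Ext.mk₀_smul, Abelian.Ext.smul_comp, Abelian.Ext.mk₀_id_comp]

theorem ext_smul_eq_zero {i : ℕ} (x : Abelian.Ext (ModuleCat.of R X) (ModuleCat.of R A) i) {y : R}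
    (hy : ∀ a : X, y • a = 0) : y • x = 0 := by
  have : LinearMap.lsmul R X y = 0 := LinearMap.ext hy
  rw [← ext_lsmul_comp, this, ModuleCat.ofHom_zero, Abelian.Ext.mk₀_zero, Abelian.Ext.zero_comp]

end ExtVanish

section Depth

set_option linter.unusedSectionVars false

open IsLocalRing Pointwise

variable {R : Type} [CommRing R] [IsLocalRing R]

/-- The depth of `L` is at least `n`, in terms of vanishing of `Ext^i(R/𝔪, L)`. -/
def DepthGE (R : Type) [CommRing R] [IsLocalRing R] (n : ℕ) (L : Type) [AddCommGroup L]
    [Module R L] : Prop :=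
  ∀ i < n, ExtVanish R i (R ⧸ maximalIdeal R) L

variable {A B D X Y : Type} [AddCommGroup A] [Module R A] [AddCommGroup B] [Module R B]
  [AddCommGroup D] [Module R D] [AddCommGroup X] [Module R X] [AddCommGroup Y] [Module R Y]
  {f : A →ₗ[R] B} {g : B →ₗ[R] D} {n : ℕ}

theorem DepthGE.zero : DepthGE R 0 A := fun _ hi => absurd hi (Nat.not_lt_zero _)

theorem DepthGE.mono {m : ℕ} (h : DepthGE R n A) (hmn : m ≤ n) : DepthGE R m A :=
  fun i hi => h i (hi.trans_le hmn)

theorem DepthGE.congr (h : DepthGE R n A) (e : B ≃ₗ[R] A) : DepthGE R n B :=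
  fun i hi => (h i hi).congr_right e

theorem DepthGE.mid (hf : Function.Injective f) (h : Function.Exact f g)
    (hg : Function.Surjective g) (hA : DepthGE R n A) (hD : DepthGE R n D) : DepthGE R n B :=
  fun i hi => (hA i hi).cov_mid hf h hg (hD i hi)

theorem extVanish_zero_of_injective (hf : Function.Injective f) (hB : ExtVanish R 0 X B) :
    ExtVanish R 0 X A := by
  rw [extVanish_zero_iff] at hB ⊢
  refine ⟨fun φ ψ => LinearMap.ext fun x => hf ?_⟩
  exact LinearMap.congr_fun (Subsingleton.elim (f ∘ₗ φ) (f ∘ₗ ψ)) x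

theorem DepthGE.left (hf : Function.Injective f) (h : Function.Exact f g)
    (hg : Function.Surjective g) (hB : DepthGE R (n + 1) B) (hD : DepthGE R n D) :
    DepthGE R (n + 1) A := by
  rintro (_ | i) hi
  · exact extVanish_zero_of_injective hf (hB 0 hi)
  · exact (hD i (by omega)).cov_left hf h hg (hB (i + 1) hi)

theorem depthGE_pi (h : DepthGE R n R) (m : ℕ) : DepthGE R n (Fin m → R) := by
  induction m with
  | zero =>
    intro i hi
    exact (h i hi).of_retract_right 0 0 (LinearMap.ext fun x => Subsingleton.elim _ _)
  | succ m ih =>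
    refine DepthGE.congr ?_ (Fin.consLinearEquiv R fun _ : Fin (m + 1) => R).symm
    exact DepthGE.mid LinearMap.inl_injective Function.Exact.inl_snd LinearMap.snd_surjective h ih

section Multiplication

theorem injective_lsmul {y : R} (hy : IsSMulRegular A y) :
    Function.Injective (LinearMap.lsmul R A y) := hy

variable {p : A →ₗ[R] D} {y : R}

theorem extVanish_succ_of_smul (hy : IsSMulRegular A y)
    (h : Function.Exact (LinearMap.lsmul R A y) p) (hp : Function.Surjective p)
    (hX : ∀ x : X, y • x = 0) {i : ℕ} (hD : ExtVanish R i X D) : ExtVanish R (i + 1) X A := by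
  have hS := exactComplex_shortExact (injective_lsmul hy) h hp
  refine subsingleton_of_forall_eq 0 fun x => ?_
  obtain ⟨z, rfl⟩ := Abelian.Ext.covariant_sequence_exact₁ _ hS x
    ((ext_comp_lsmul x y).trans (ext_smul_eq_zero x hX)) rfl
  rw [hD.elim z 0, Abelian.Ext.zero_comp]

theorem smul_residue_eq_zero (hy : y ∈ maximalIdeal R) (x : R ⧸ maximalIdeal R) : y • x = 0 := by
  obtain ⟨x, rfl⟩ := Submodule.Quotient.mk_surjective _ x
  rw [← Submodule.Quotient.mk_smul, Submodule.Quotient.mk_eq_zero]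
  exact Ideal.mul_mem_right _ _ hy

theorem extVanish_zero_of_smul (hy : IsSMulRegular A y) (hX : ∀ x : X, y • x = 0) :
    ExtVanish R 0 X A := by
  rw [extVanish_zero_iff]
  refine subsingleton_of_forall_eq 0 fun φ => LinearMap.ext fun x => hy ?_
  change y • φ x = y • (0 : A)
  rw [smul_zero, ← map_smul, hX, map_zero]

theorem DepthGE.of_smul (hm : y ∈ maximalIdeal R) (hy : IsSMulRegular A y)
    (h : Function.Exact (LinearMap.lsmul R A y) p) (hp : Function.Surjective p)
    (hD : DepthGE R n D) : DepthGE R (n + 1) A := by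
  rintro (_ | i) hi
  · exact extVanish_zero_of_smul hy (smul_residue_eq_zero hm)
  · exact extVanish_succ_of_smul hy h hp (smul_residue_eq_zero hm) (hD i (by omega))

theorem DepthGE.quotient (hy : IsSMulRegular A y)
    (h : Function.Exact (LinearMap.lsmul R A y) p) (hp : Function.Surjective p)
    (hA : DepthGE R (n + 1) A) : DepthGE R n D :=
  fun i hi => (hA i (by omega)).cov_right (injective_lsmul hy) h hp (hA (i + 1) (by omega))

theorem ExtVanish.of_smul [IsNoetherianRing R] [Module.Finite R A] [Module.Finite R Y]
    (hm : y ∈ maximalIdeal R) (hy : IsSMulRegular A y)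
    (h : Function.Exact (LinearMap.lsmul R A y) p) (hp : Function.Surjective p) {i : ℕ}
    (hD : ExtVanish R (i + 1) D Y) : ExtVanish R i A Y := by
  have hS := exactComplex_shortExact (injective_lsmul hy) h hp
  have hfin : Module.Finite R (Abelian.Ext (ModuleCat.of R A) (ModuleCat.of R Y) i) :=
    inferInstance
  have htop : (⊤ : Submodule R (Abelian.Ext (ModuleCat.of R A) (ModuleCat.of R Y) i)) = ⊥ := by
    refine Submodule.eq_bot_of_le_smul_of_le_jacobson_bot (maximalIdeal R) _ hfin.fg_top ?_
      (maximalIdeal_le_jacobson _)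
    intro x _
    obtain ⟨z, hz⟩ := Abelian.Ext.contravariant_sequence_exact₁ hS _ x (add_comm 1 i)
      (hD.elim _ _)
    rw [← hz]
    exact (ext_lsmul_comp z y).symm ▸ Submodule.smul_mem_smul hm Submodule.mem_top
  exact (Submodule.subsingleton_iff R).1 (subsingleton_of_bot_eq_top htop.symm)

end Multiplication

section Hom

theorem exact_compRight (hf : Function.Injective f) (h : Function.Exact f g) :
    Function.Exact (f.compRight R (M := X)) (g.compRight R (M := X)) := by
  intro φ
  constructor
  · intro hφ
    have hr : ∀ x, φ x ∈ LinearMap.range f := fun x =>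
      (h (φ x)).1 (LinearMap.congr_fun hφ x)
    let e := LinearEquiv.ofInjective f hf
    refine ⟨e.symm.toLinearMap ∘ₗ φ.codRestrict _ hr, LinearMap.ext fun x => ?_⟩
    exact congrArg Subtype.val (e.apply_symm_apply ⟨φ x, hr x⟩)
  · rintro ⟨ψ, rfl⟩
    exact LinearMap.ext fun x => h.apply_apply_eq_zero (ψ x)

theorem isSMulRegular_hom {y : R} (hy : IsSMulRegular A y) : IsSMulRegular (X →ₗ[R] A) y :=
  fun _ _ h => LinearMap.ext fun x => hy (LinearMap.congr_fun h x)

theorem exact_lsmul_compRight {y : R} {p : A →ₗ[R] D} (hy : IsSMulRegular A y)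
    (h : Function.Exact (LinearMap.lsmul R A y) p) :
    Function.Exact (LinearMap.lsmul R (X →ₗ[R] A) y) (p.compRight R (M := X)) :=
  exact_compRight (injective_lsmul hy) h

theorem exact_lsmul_mkQ (y : R) : Function.Exact (LinearMap.lsmul R A y)
    (y • (⊤ : Submodule R A)).mkQ := LinearMap.exact_lsmul_mkQ_smul_top A y

variable [IsNoetherianRing R]

theorem exists_regular_of_extVanish_zero [Module.Finite R A]
    (h : ExtVanish R 0 (R ⧸ maximalIdeal R) A) : ∃ y ∈ maximalIdeal R, IsSMulRegular A y := by
  rw [extVanish_zero_iff, IsSMulRegular.subsingleton_linearMap_iff] at h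
  simpa only [Ideal.annihilator_quotient] using h

/-- If `Ext^i(X, A) = 0` for `1 ≤ i < d`, then `Hom(X, A)` has depth at least `d` as soon as `A`
has. -/
theorem DepthGE.hom [Module.Finite R A] (hA : DepthGE R n A)
    (hext : ∀ i, 1 ≤ i → i < n → ExtVanish R i X A) : DepthGE R n (X →ₗ[R] A) := by
  induction n generalizing A with
  | zero => exact DepthGE.zero
  | succ n ih =>
    obtain ⟨y, hm, hy⟩ := exists_regular_of_extVanish_zero (hA 0 n.succ_pos)
    have hex := exact_lsmul_mkQ (A := A) y
    have hsurj := Submodule.mkQ_surjective (y • (⊤ : Submodule R A))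
    cases n with
    | zero =>
      exact DepthGE.of_smul hm (isSMulRegular_hom hy) (exact_lsmul_mkQ y)
        (Submodule.mkQ_surjective _) DepthGE.zero
    | succ n =>
      refine DepthGE.of_smul hm (isSMulRegular_hom hy) (exact_lsmul_compRight hy hex) ?_
        (ih (DepthGE.quotient hy hex hsurj hA) fun i hi hin =>
          (hext i hi (by omega)).cov_right (injective_lsmul hy) hex hsurj
            (hext (i + 1) (by omega) (by omega)))
      exact fun φ => (hext 1 le_rfl (by omega)).exists_lift (injective_lsmul hy) hex hsurj φ

theorem exists_surjective_residue [Module.Finite R X] [Nontrivial X] :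
    ∃ q : X →ₗ[R] R ⧸ maximalIdeal R, Function.Surjective q := by
  obtain ⟨P, hP, -⟩ := (eq_top_or_exists_le_coatom (⊥ : Submodule R X)).resolve_left bot_ne_top
  obtain ⟨I, hI, ⟨e⟩⟩ := isSimpleModule_iff_quot_maximal.1 (isSimpleModule_iff_isCoatom.2 hP)
  obtain rfl := eq_maximalIdeal hI
  exact ⟨e.toLinearMap ∘ₗ P.mkQ, e.surjective.comp P.mkQ_surjective⟩

/-- If `Ext^i(X, A) = 0` for all `i ≥ 1`, then the depth of `A` is at least that of `Hom(X, A)`. -/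
theorem DepthGE.of_hom [Module.Finite R A] [Module.Finite R X] [Nontrivial X]
    (hext : ∀ i, 1 ≤ i → ExtVanish R i X A) (hA : DepthGE R n (X →ₗ[R] A)) : DepthGE R n A := by
  induction n generalizing A with
  | zero => exact DepthGE.zero
  | succ n ih =>
    obtain ⟨q, hq⟩ := exists_surjective_residue (R := R) (X := X)
    have h0 : ExtVanish R 0 (R ⧸ maximalIdeal R) A := by
      obtain ⟨z, hzm, hz⟩ := exists_regular_of_extVanish_zero (hA 0 n.succ_pos)
      rw [extVanish_zero_iff]
      refine subsingleton_of_forall_eq 0 fun φ => ?_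
      have hφ : φ ∘ₗ q = 0 := by
        refine hz (?_ : z • (φ ∘ₗ q) = z • (0 : X →ₗ[R] A))
        refine LinearMap.ext fun x => ?_
        rw [smul_zero, LinearMap.smul_apply, LinearMap.comp_apply, ← map_smul,
          smul_residue_eq_zero hzm, map_zero, LinearMap.zero_apply]
      exact (LinearMap.cancel_right hq).1 (hφ.trans (LinearMap.zero_comp q).symm)
    obtain ⟨y, hm, hy⟩ := exists_regular_of_extVanish_zero h0
    have hex := exact_lsmul_mkQ (A := A) y
    have hsurj := Submodule.mkQ_surjective (y • (⊤ : Submodule R A))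
    refine DepthGE.of_smul hm hy hex hsurj (ih (fun i hi =>
      (hext i hi).cov_right (injective_lsmul hy) hex hsurj (hext (i + 1) (by omega))) ?_)
    exact DepthGE.quotient (isSMulRegular_hom hy) (exact_lsmul_compRight hy hex)
      (fun φ => (hext 1 le_rfl).exists_lift (injective_lsmul hy) hex hsurj φ) hA

/-- `Ext^i(-, Y)` vanishes on finitely generated modules for all `i > n`. -/
def InjDimLE (R : Type) [CommRing R] (n : ℕ) (Y : Type) [AddCommGroup Y] [Module R Y] : Prop :=
  ∀ (L : Type) [AddCommGroup L] [Module R L] [Module.Finite R L], ∀ i, n < i → ExtVanish R i L Y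

/-- If `Ext^i(-, Y)` vanishes on finitely generated modules for `i > n`, then `Ext^i(A, Y) = 0`
whenever `i + depth A > n`. -/
theorem DepthGE.extVanish [Module.Finite R A] [Module.Finite R Y] {e : ℕ}
    (hY : InjDimLE R n Y) (hA : DepthGE R e A) {i : ℕ} (hi : n < i + e) : ExtVanish R i A Y := by
  induction e generalizing A i with
  | zero => exact hY A i hi
  | succ e ih =>
    obtain ⟨y, hm, hy⟩ := exists_regular_of_extVanish_zero (hA 0 e.succ_pos)
    have hex := exact_lsmul_mkQ (A := A) y
    have hsurj := Submodule.mkQ_surjective (y • (⊤ : Submodule R A))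
    exact ExtVanish.of_smul hm hy hex hsurj
      (ih (DepthGE.quotient hy hex hsurj hA) (by omega))

theorem DepthGE.le_ringKrullDim (h : DepthGE R n R) : (n : WithBot ℕ∞) ≤ ringKrullDim R := by
  have hlt : maximalIdeal R • (⊤ : Submodule R (ModuleCat.of R R)) < ⊤ := by
    change maximalIdeal R • (⊤ : Ideal R) < ⊤
    rw [smul_eq_mul, Ideal.mul_top]
    exact (Ideal.IsPrime.ne_top inferInstance).lt_top
  obtain ⟨rs, rfl, -, hreg⟩ := ModuleCat.exists_isRegular_of_exists_subsingleton_ext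
    (maximalIdeal R) n (ModuleCat.of R R) hlt (ModuleCat.of R (R ⧸ maximalIdeal R))
    (by rw [Module.support_eq_zeroLocus, Ideal.annihilator_quotient]) h
  rw [← ringKrullDim_add_length_eq_ringKrullDim_of_isRegular rs hreg]
  have : Nontrivial (R ⧸ Ideal.ofList rs) := by
    refine Ideal.Quotient.nontrivial_iff.2 fun htop => hreg.top_ne_smul ?_
    rw [htop, Submodule.top_smul]
  exact le_add_of_nonneg_left ringKrullDim_nonneg_of_nontrivial

end Hom

end Depth

section InjectiveDimension

open IsLocalRing Pointwise

set_option linter.unusedSectionVars false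

variable {R : Type} [CommRing R] [IsLocalRing R] [IsNoetherianRing R]
  {Y : Type} [AddCommGroup Y] [Module R Y] [Module.Finite R Y] {n t : ℕ}

theorem exists_depthGE_and_not_extVanish {d : ℕ} (hd : ringKrullDim R = d) :
    ∃ t ≤ d, DepthGE R t R ∧ ¬ ExtVanish R t (R ⧸ maximalIdeal R) R := by
  classical
  have hex : ∃ i, ¬ ExtVanish R i (R ⧸ maximalIdeal R) R := by
    by_contra! hall
    have hle := DepthGE.le_ringKrullDim (R := R) (n := d + 1) fun i _ => hall i
    rw [hd] at hle
    have : d + 1 ≤ d := by exact_mod_cast hle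
    omega
  have hdepth : DepthGE R (Nat.find hex) R := fun i hi => not_not.1 (Nat.find_min hex hi)
  refine ⟨Nat.find hex, ?_, hdepth, Nat.find_spec hex⟩
  have hle := hdepth.le_ringKrullDim
  rw [hd] at hle
  exact_mod_cast hle

/-- Quotients of `R` by regular sequences of length `j`. -/
theorem exists_quotient_by_regular (ht : DepthGE R t R)
    (ht' : ¬ ExtVanish R t (R ⧸ maximalIdeal R) R) (j e : ℕ) (hj : j + e = t) :
    ∃ (L : Type) (_ : AddCommGroup L) (_ : Module R L), Module.Finite R L ∧ DepthGE R e L ∧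
      ¬ ExtVanish R e (R ⧸ maximalIdeal R) L ∧
      ∀ (Y : Type) [AddCommGroup Y] [Module R Y], ∀ i, j < i → ExtVanish R i L Y := by
  induction j generalizing e with
  | zero =>
    obtain rfl : e = t := by omega
    refine ⟨R, _, _, inferInstance, ht, ht', fun Y _ _ i hi => ?_⟩
    obtain ⟨i, rfl⟩ := Nat.exists_eq_succ_of_ne_zero hi.ne'
    exact extVanish_of_projective i
  | succ j ih =>
    obtain ⟨L, _, _, _, hL, hL', hext⟩ := ih (e + 1) (by omega)
    obtain ⟨y, hm, hy⟩ := exists_regular_of_extVanish_zero (hL 0 e.succ_pos)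
    have hex := exact_lsmul_mkQ (A := L) y
    have hsurj := Submodule.mkQ_surjective (y • (⊤ : Submodule R L))
    refine ⟨L ⧸ y • (⊤ : Submodule R L), inferInstance, inferInstance, inferInstance,
      DepthGE.quotient hy hex hsurj hL, fun h => hL' ?_, fun Y _ _ i hi => ?_⟩
    · exact extVanish_succ_of_smul hy hex hsurj (smul_residue_eq_zero hm) h
    · obtain ⟨i, rfl⟩ := Nat.exists_eq_succ_of_ne_zero (by omega : i ≠ 0)
      exact (hext Y i (by omega)).contra_right (injective_lsmul hy) hex hsurj
        (hext Y (i + 1) (by omega))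

instance : IsSimpleModule R (R ⧸ maximalIdeal R) :=
  isSimpleModule_iff_quot_maximal.2 ⟨_, inferInstance, ⟨LinearEquiv.refl R _⟩⟩

theorem extVanish_residue_of_injDimLE (ht : DepthGE R t R)
    (ht' : ¬ ExtVanish R t (R ⧸ maximalIdeal R) R) (hY : InjDimLE R n Y) (htn : t < n) :
    ExtVanish R n (R ⧸ maximalIdeal R) Y := by
  obtain ⟨L, _, _, _, -, hL, hext⟩ := exists_quotient_by_regular ht ht' t 0 rfl
  rw [extVanish_zero_iff, not_subsingleton_iff_nontrivial] at hL
  obtain ⟨φ, hφ⟩ := exists_ne (0 : (R ⧸ maximalIdeal R) →ₗ[R] L)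
  have hinj := φ.injective_or_eq_zero.resolve_right hφ
  exact (hext Y n htn).contra_left hinj (LinearMap.exact_map_mkQ_range φ)
    (Submodule.mkQ_surjective _) (hY _ (n + 1) n.lt_succ_self)

theorem InjDimLE.of_succ (ht : DepthGE R t R) (ht' : ¬ ExtVanish R t (R ⧸ maximalIdeal R) R)
    (htn : t ≤ n) (hY : InjDimLE R (n + 1) Y) : InjDimLE R n Y := by
  suffices h : ∀ (L : Type) [AddCommGroup L] [Module R L] [Module.Finite R L],
      ExtVanish R (n + 1) L Y by
    intro L _ _ _ i hi
    obtain rfl | hlt := (show n + 1 ≤ i from hi).eq_or_lt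
    exacts [h L, hY L i hlt]
  intro L _ _ hL
  induction hL using IsNoetherianRing.induction_on_isQuotientEquivQuotientPrime R with
  | subsingleton L =>
    exact ((extVanish_of_projective (A := R) n).of_retract_left 0 0
      (LinearMap.ext fun x => Subsingleton.elim _ _))
  | exact A B D f g hf hg hfg hA hD => exact hA.contra_mid hf hfg hg hD
  | quotient L p e =>
    refine ExtVanish.congr_left ?_ e
    by_cases hp : p.1 = maximalIdeal R
    · rw [hp]
      exact extVanish_residue_of_injDimLE ht ht' hY (by omega)
    · obtain ⟨y, hm, hyp⟩ := SetLike.exists_of_lt (lt_of_le_of_ne (le_maximalIdeal p.2.ne_top) hp)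
      have hy : IsSMulRegular (R ⧸ p.1) y := by
        intro a b hab
        obtain ⟨a, rfl⟩ := Ideal.Quotient.mk_surjective a
        obtain ⟨b, rfl⟩ := Ideal.Quotient.mk_surjective b
        have h : y * (a - b) ∈ p.1 := by
          rw [mul_sub]
          exact Ideal.Quotient.eq.1 hab
        exact Ideal.Quotient.eq.2 ((p.2.mem_or_mem h).resolve_left hyp)
      exact ExtVanish.of_smul hm hy (exact_lsmul_mkQ y) (Submodule.mkQ_surjective _)
        (hY _ (n + 1 + 1) (by omega))

/-- Finite injective dimension is bounded by the depth of the ring. -/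
theorem InjDimLE.le_depth (ht : DepthGE R t R) (ht' : ¬ ExtVanish R t (R ⧸ maximalIdeal R) R)
    (hY : InjDimLE R n Y) : InjDimLE R t Y := by
  obtain hnt | htn := le_total n t
  · exact fun L _ _ _ i hi => hY L i (by omega)
  · induction n, htn using Nat.le_induction with
    | base => exact hY
    | succ n hn ih => exact ih (hY.of_succ ht ht' hn)

end InjectiveDimension

section DoubleDual

open TensorProduct

variable {R : Type} [CommRing R]

/-- The natural map `L ⊗ Hom(C, N) → Hom(Hom(L, C), N)`, sending `l ⊗ u` to `φ ↦ u (φ l)`. -/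
def tensorEval (R : Type) [CommRing R] (C N L : Type) [AddCommGroup C] [Module R C]
    [AddCommGroup N] [Module R N] [AddCommGroup L] [Module R L] :
    L ⊗[R] (C →ₗ[R] N) →ₗ[R] ((L →ₗ[R] C) →ₗ[R] N) :=
  TensorProduct.lift ((LinearMap.llcomp R (L →ₗ[R] C) C N).flip.comp LinearMap.applyₗ)

variable {C N A B L : Type} [AddCommGroup C] [Module R C] [AddCommGroup N] [Module R N]
  [AddCommGroup A] [Module R A] [AddCommGroup B] [Module R B] [AddCommGroup L] [Module R L]

theorem tensorEval_tmul (l : L) (u : C →ₗ[R] N) (φ : L →ₗ[R] C) :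
    tensorEval R C N L (l ⊗ₜ u) φ = u (φ l) := rfl

theorem tensorEval_rTensor (f : A →ₗ[R] B) (z : A ⊗[R] (C →ₗ[R] N)) :
    tensorEval R C N B (f.rTensor _ z) = tensorEval R C N A z ∘ₗ f.lcomp R C := by
  induction z with
  | zero => rw [map_zero, map_zero, map_zero, LinearMap.zero_comp]
  | add x y hx hy => rw [map_add, map_add, map_add, hx, hy, LinearMap.add_comp]
  | tmul a u => rfl

theorem tensorEval_pi_bijective (n : ℕ) : Function.Bijective (tensorEval R C N (Fin n → R)) := by
  classical
  let e (i : Fin n) : C →ₗ[R] (Fin n → R) →ₗ[R] C :=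
    LinearMap.flip ((LinearMap.lsmul R C).comp (LinearMap.proj i))
  let Φ : (((Fin n → R) →ₗ[R] C) →ₗ[R] N) → (Fin n → R) ⊗[R] (C →ₗ[R] N) :=
    fun F => ∑ i, Pi.single i 1 ⊗ₜ (F ∘ₗ e i)
  refine Function.bijective_iff_has_inverse.2 ⟨Φ, fun z => ?_, fun F => ?_⟩
  · induction z with
    | zero => simp [Φ]
    | add x y hx hy =>
      rw [map_add]
      simp only [Φ, LinearMap.add_comp, TensorProduct.tmul_add, Finset.sum_add_distrib] at hx hy ⊢
      rw [hx, hy]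
    | tmul g u =>
      have h (i : Fin n) : tensorEval R C N _ (g ⊗ₜ u) ∘ₗ e i = g i • u := by
        refine LinearMap.ext fun c => ?_
        exact u.map_smul (g i) c
      simp only [Φ, h]
      simp only [← TensorProduct.smul_tmul, ← TensorProduct.sum_tmul]
      congr 1
      exact (pi_eq_sum_univ' g).symm
  · refine LinearMap.ext fun φ => ?_
    simp only [Φ, map_sum, LinearMap.sum_apply, tensorEval_tmul, LinearMap.comp_apply]
    rw [← map_sum]
    congr 1
    refine LinearMap.pi_ext' fun i => LinearMap.ext_ring ?_
    simp only [LinearMap.comp_apply, LinearMap.sum_apply]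
    rw [Finset.sum_eq_single i]
    · simp [e]
    · intro j _ hj
      simp [e, hj]
    · simp

section Presentation

set_option linter.unusedSectionVars false

open IsLocalRing

variable [IsLocalRing R] [IsNoetherianRing R] [Module.Finite R C] [Module.Finite R L] {d n : ℕ}
  {g : (Fin n → R) →ₗ[R] L}

/-- `Ext^i(-, N)` vanishes for all `i ≥ 1` on finitely generated modules of depth at least `d`. -/
def AcyclicOnDepthGE (R : Type) [CommRing R] [IsLocalRing R] (d : ℕ) (N : Type) [AddCommGroup N]
    [Module R N] : Prop :=
  ∀ (X : Type) [AddCommGroup X] [Module R X] [Module.Finite R X], DepthGE R d X →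
    ∀ i, 1 ≤ i → ExtVanish R i X N

theorem InjDimLE.acyclicOnDepthGE [Module.Finite R N] (hN : InjDimLE R d N) :
    AcyclicOnDepthGE R d N :=
  fun _ _ _ _ hX i hi => hX.extVanish hN (by omega)

theorem extVanish_ker (hg : Function.Surjective g)
    (hL : ∀ i, 1 ≤ i → ExtVanish R i L C) (i : ℕ) (hi : 1 ≤ i) :
    ExtVanish R i (LinearMap.ker g) C := by
  obtain ⟨i, rfl⟩ := Nat.exists_eq_succ_of_ne_zero (by omega : i ≠ 0)
  exact (extVanish_of_projective i).contra_left Subtype.val_injective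
    (LinearMap.exact_subtype_ker_map g) hg (hL _ (by omega))

theorem lcomp_ker_subtype_surjective (hg : Function.Surjective g)
    (hL : ∀ i, 1 ≤ i → ExtVanish R i L C) :
    Function.Surjective ((LinearMap.ker g).subtype.lcomp R C) :=
  fun φ => (hL 1 le_rfl).exists_extension Subtype.val_injective
    (LinearMap.exact_subtype_ker_map g) hg φ

theorem extVanish_one_hom_ker (hC : DepthGE R d C) (hN : AcyclicOnDepthGE R d N)
    (hg : Function.Surjective g) (hL : ∀ i, 1 ≤ i → ExtVanish R i L C) :
    ExtVanish R 1 (LinearMap.ker g →ₗ[R] C) N :=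
  hN _ (hC.hom fun i hi _ => extVanish_ker hg hL i hi) 1 le_rfl

theorem tensorEval_surjective (hC : DepthGE R d C) (hN : AcyclicOnDepthGE R d N)
    (hL : ∀ i, 1 ≤ i → ExtVanish R i L C) : Function.Surjective (tensorEval R C N L) := by
  obtain ⟨n, g, hg⟩ := Module.Finite.exists_fin' R L
  intro F
  obtain ⟨F', rfl⟩ := (extVanish_one_hom_ker hC hN hg hL).exists_extension
    (LinearMap.lcomp_injective_of_surjective g hg)
    (LinearMap.exact_lcomp_of_exact_of_surjective C (LinearMap.exact_subtype_ker_map g) hg)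
    (lcomp_ker_subtype_surjective hg hL) F
  obtain ⟨z, rfl⟩ := (tensorEval_pi_bijective n).2 F'
  exact ⟨g.rTensor _ z, tensorEval_rTensor g z⟩

theorem tensorEval_injective (hC : DepthGE R d C) (hN : AcyclicOnDepthGE R d N)
    (hL : ∀ i, 1 ≤ i → ExtVanish R i L C) : Function.Injective (tensorEval R C N L) := by
  obtain ⟨n, g, hg⟩ := Module.Finite.exists_fin' R L
  refine (injective_iff_map_eq_zero _).2 fun w hw => ?_
  obtain ⟨z, rfl⟩ := LinearMap.rTensor_surjective _ hg w
  rw [tensorEval_rTensor] at hw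
  obtain ⟨P, hP⟩ := (LinearMap.exact_lcomp_of_exact_of_surjective N
    (LinearMap.exact_lcomp_of_exact_of_surjective C (LinearMap.exact_subtype_ker_map g) hg)
    (lcomp_ker_subtype_surjective hg hL) (tensorEval R C N _ z)).1 hw
  obtain ⟨v, rfl⟩ := tensorEval_surjective hC hN (extVanish_ker hg hL) P
  rw [LinearMap.lcomp_apply', ← tensorEval_rTensor] at hP
  rw [← (tensorEval_pi_bijective n).1 hP, ← LinearMap.rTensor_comp_apply,
    (LinearMap.exact_subtype_ker_map g).linearMap_comp_eq_zero, LinearMap.rTensor_zero,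
    LinearMap.zero_apply]

/-- `Tor_1(L, Hom(C, N)) = 0`, expressed through a presentation of `L`. -/
theorem rTensor_ker_subtype_injective (hC : DepthGE R d C) (hN : AcyclicOnDepthGE R d N)
    (hg : Function.Surjective g) (hL : ∀ i, 1 ≤ i → ExtVanish R i L C) :
    Function.Injective ((LinearMap.ker g).subtype.rTensor (C →ₗ[R] N)) := by
  refine (injective_iff_map_eq_zero _).2 fun v hv => ?_
  refine (injective_iff_map_eq_zero _).1 (tensorEval_injective hC hN (extVanish_ker hg hL)) v ?_
  refine (LinearMap.cancel_right (lcomp_ker_subtype_surjective hg hL)).1 ?_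
  rw [← tensorEval_rTensor, hv, map_zero, LinearMap.zero_comp]

end Presentation

end DoubleDual

section Homothety

open TensorProduct IsLocalRing

set_option linter.unusedSectionVars false

variable {R : Type} [CommRing R] [IsLocalRing R] [IsNoetherianRing R]
  {C H X : Type} [AddCommGroup C] [Module R C] [Module.Finite R C]
  [AddCommGroup H] [Module R H] [Module.Finite R H]
  [AddCommGroup X] [Module R X] [Module.Finite R X]

theorem subsingleton_of_subsingleton_tensorProduct [Nontrivial C]
    (h : Subsingleton (C ⊗[R] X)) : Subsingleton X := by
  obtain ⟨q, hq⟩ := exists_surjective_residue (R := R) (X := C)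
  have : Subsingleton ((R ⧸ maximalIdeal R) ⊗[R] X) :=
    (LinearMap.rTensor_surjective X hq).subsingleton
  exact IsLocalRing.subsingleton_tensorProduct.1 this

variable {d : ℕ}

theorem tensorEval_id_injective (hC : Function.Bijective (LinearMap.lsmul R C))
    (hext : ∀ i, 1 ≤ i → ExtVanish R i C C) (hd : DepthGE R d C)
    (hN : AcyclicOnDepthGE R d (C ⊗[R] H)) :
    Function.Injective ((LinearMap.applyₗ (R := R) (LinearMap.id (R := R) (M := C))) ∘ₗ
      tensorEval R C (C ⊗[R] H) C) := by
  intro z w h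
  refine tensorEval_injective hd hN hext (LinearMap.ext fun φ => ?_)
  obtain ⟨r, rfl⟩ := hC.2 φ
  have hr : LinearMap.lsmul R C r = r • LinearMap.id := rfl
  rw [hr, map_smul, map_smul]
  exact congrArg (r • ·) h

theorem tensorEval_id_comp_lTensor :
    ((LinearMap.applyₗ (R := R) (LinearMap.id (R := R) (M := C))) ∘ₗ
      tensorEval R C (C ⊗[R] H) C) ∘ₗ
      (TensorProduct.mk R C H).flip.lTensor C = LinearMap.id :=
  TensorProduct.ext' fun _ _ => rfl

theorem lTensor_mk_flip_bijective (hC : Function.Bijective (LinearMap.lsmul R C))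
    (hext : ∀ i, 1 ≤ i → ExtVanish R i C C) (hd : DepthGE R d C)
    (hN : AcyclicOnDepthGE R d (C ⊗[R] H)) :
    Function.Bijective ((TensorProduct.mk R C H).flip.lTensor C) := by
  have h (z : C ⊗[R] H) := LinearMap.congr_fun (tensorEval_id_comp_lTensor (R := R)) z
  refine ⟨fun z w hzw => ?_, fun z => ⟨_, tensorEval_id_injective hC hext hd hN (h _)⟩⟩
  rw [← LinearMap.id_apply (R := R) z, ← h, LinearMap.comp_apply, hzw]
  exact h w

/-- If `Ext^i(-, C ⊗ H)` vanishes on modules of maximal depth, then `H → Hom(C, C ⊗ H)` is an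
isomorphism. -/
theorem mk_flip_bijective [Nontrivial C] (hC : Function.Bijective (LinearMap.lsmul R C))
    (hext : ∀ i, 1 ≤ i → ExtVanish R i C C) (hd : DepthGE R d C)
    (hN : AcyclicOnDepthGE R d (C ⊗[R] H)) :
    Function.Bijective (TensorProduct.mk R C H).flip := by
  set η := (TensorProduct.mk R C H).flip with hη
  have hbij : Function.Bijective (η.lTensor C) := lTensor_mk_flip_bijective hC hext hd hN
  have hsurj : Function.Surjective η := by
    have hsub : Subsingleton (C ⊗[R] ((C →ₗ[R] C ⊗[R] H) ⧸ LinearMap.range η)) := by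
      refine subsingleton_of_forall_eq 0 fun z => ?_
      obtain ⟨w, rfl⟩ := LinearMap.lTensor_surjective C (Submodule.mkQ_surjective _) z
      obtain ⟨v, rfl⟩ := hbij.2 w
      rw [← LinearMap.lTensor_comp_apply, (LinearMap.exact_map_mkQ_range η).linearMap_comp_eq_zero,
        LinearMap.lTensor_zero, LinearMap.zero_apply]
    have := subsingleton_of_subsingleton_tensorProduct hsub
    exact LinearMap.range_eq_top.1 (Submodule.Quotient.subsingleton_iff.1 this)
  refine ⟨?_, hsurj⟩
  obtain ⟨n, g, hg⟩ := Module.Finite.exists_fin' R C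
  have hinj : Function.Injective ((LinearMap.ker η).subtype.lTensor C) :=
    lTensor_injective_of_exact_of_exact_of_rTensor_injective
      (LinearMap.exact_subtype_ker_map g) hg (LinearMap.exact_subtype_ker_map η) hsurj
      (rTensor_ker_subtype_injective hd hN hg hext)
      (Module.Flat.lTensor_preserves_injective_linearMap _ Subtype.val_injective)
  have hsub : Subsingleton (C ⊗[R] LinearMap.ker η) := by
    refine subsingleton_of_forall_eq 0 fun z => hinj (hbij.1 ?_)
    rw [map_zero, ← LinearMap.lTensor_comp_apply,
      (LinearMap.exact_subtype_ker_map η).linearMap_comp_eq_zero, LinearMap.lTensor_zero,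
      LinearMap.zero_apply, map_zero]
  have := subsingleton_of_subsingleton_tensorProduct hsub
  exact LinearMap.ker_eq_bot.1 (Submodule.subsingleton_iff_eq_bot.1 this)

end Homothety

section Freeness

open TensorProduct IsLocalRing

set_option linter.unusedSectionVars false

variable {R : Type} [CommRing R] [IsLocalRing R]
  {L X : Type} [AddCommGroup L] [Module R L] [AddCommGroup X] [Module R X]

/-- `Tor_1(L, X) = 0`, expressed through presentations of `X`. -/
def TorOneVanish (R : Type) [CommRing R] (L X : Type) [AddCommGroup L] [Module R L]
    [AddCommGroup X] [Module R X] : Prop :=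
  ∀ (n : ℕ) (h : (Fin n → R) →ₗ[R] X), Function.Surjective h →
    Function.Injective ((LinearMap.ker h).subtype.lTensor L)

theorem TorOneVanish.of_rTensor_injective {K F : Type} [AddCommGroup K] [Module R K]
    [AddCommGroup F] [Module R F] [Module.Flat R F] {f : K →ₗ[R] F} {g : F →ₗ[R] L}
    (hfg : Function.Exact f g) (hg : Function.Surjective g)
    (h : Function.Injective (f.rTensor X)) : TorOneVanish R L X :=
  fun _ p hp => lTensor_injective_of_exact_of_exact_of_rTensor_injective hfg hg
    (LinearMap.exact_subtype_ker_map p) hp h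
    (Module.Flat.lTensor_preserves_injective_linearMap _ Subtype.val_injective)

theorem TorOneVanish.rTensor_injective [Module.Finite R X] {K F : Type} [AddCommGroup K]
    [Module R K] [AddCommGroup F] [Module R F] [Module.Flat R F] {f : K →ₗ[R] F}
    {g : F →ₗ[R] L} (hf : Function.Injective f) (hfg : Function.Exact f g)
    (hg : Function.Surjective g) (h : TorOneVanish R L X) : Function.Injective (f.rTensor X) := by
  obtain ⟨n, p, hp⟩ := Module.Finite.exists_fin' R X
  rw [← LinearMap.lTensor_inj_iff_rTensor_inj]
  refine lTensor_injective_of_exact_of_exact_of_rTensor_injective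
    (LinearMap.exact_subtype_ker_map p) hp hfg hg ?_
    (Module.Flat.lTensor_preserves_injective_linearMap _ hf)
  rw [← LinearMap.lTensor_inj_iff_rTensor_inj]
  exact h n p hp

/-- Dimension shifting: `Tor_1(Ω L, X) = 0` implies `Tor_1(L, Ω X) = 0`. -/
theorem TorOneVanish.shift {n m : ℕ} {g : (Fin n → R) →ₗ[R] L} (hg : Function.Surjective g)
    {p : (Fin m → R) →ₗ[R] X} (hp : Function.Surjective p)
    (h : TorOneVanish R (LinearMap.ker g) X) : TorOneVanish R L (LinearMap.ker p) := by
  refine .of_rTensor_injective (LinearMap.exact_subtype_ker_map g) hg ?_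
  have h₁ : Function.Injective ((LinearMap.ker p).subtype.lTensor (LinearMap.ker g)) := h m p hp
  have h₂ : Function.Injective ((LinearMap.ker g).subtype.rTensor (Fin m → R)) :=
    Module.Flat.rTensor_preserves_injective_linearMap _ Subtype.val_injective
  have h₃ := h₂.comp h₁
  rw [← LinearMap.coe_comp, LinearMap.rTensor_comp_lTensor, ← LinearMap.lTensor_comp_rTensor,
    LinearMap.coe_comp] at h₃
  exact h₃.of_comp

theorem free_of_torOneVanish_residue [IsNoetherianRing R] [Module.Finite R X]
    (h : TorOneVanish R (R ⧸ maximalIdeal R) X) : Module.Free R X :=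
  have := Module.finitePresentation_of_finite R X
  Module.free_of_maximalIdeal_rTensor_injective
    (h.rTensor_injective Subtype.val_injective (LinearMap.exact_subtype_mkQ _)
      (Submodule.mkQ_surjective _))

/-- A finite module over a local ring has a presentation whose relations have entries in the
maximal ideal. -/
theorem exists_minimal_presentation (R : Type) [CommRing R] [IsLocalRing R] (X : Type)
    [AddCommGroup X] [Module R X] [Module.Finite R X] :
    ∃ (n : ℕ) (p : (Fin n → R) →ₗ[R] X), Function.Surjective p ∧
      ∀ v ∈ LinearMap.ker p, ∀ i, v i ∈ maximalIdeal R := by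
  classical
  have hex : ∃ n : ℕ, ∃ p : (Fin n → R) →ₗ[R] X, Function.Surjective p :=
    Module.Finite.exists_fin' R X
  obtain ⟨p, hp⟩ := Nat.find_spec hex
  refine ⟨_, p, hp, fun v hv i => by_contra fun hi => ?_⟩
  have hmin := fun m => Nat.find_min (m := m) hex
  generalize Nat.find hex = n at *
  obtain _ | n := n
  · exact i.elim0
  refine hmin n n.lt_succ_self ⟨p ∘ₗ Fintype.linearCombination R
    (fun j => Pi.single (i.succAbove j) (1 : R)), fun x => ?_⟩
  obtain ⟨w, rfl⟩ := hp x
  obtain ⟨u, hu⟩ := (notMem_maximalIdeal.1 hi).exists_left_inv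
  refine ⟨fun j => (w - (w i * u) • v) (i.succAbove j), ?_⟩
  have hw : p w = p (w - (w i * u) • v) := by
    rw [map_sub, map_smul, LinearMap.mem_ker.1 hv, smul_zero, sub_zero]
  rw [hw, LinearMap.comp_apply]
  congr 1
  have hwi : (w - (w i * u) • v) i = 0 := by
    simp [mul_assoc, hu]
  generalize w - (w i * u) • v = w' at hwi
  rw [Fintype.linearCombination_apply]
  nth_rewrite 2 [pi_eq_sum_univ' w']
  rw [Fin.sum_univ_succAbove _ i, hwi, zero_smul, zero_add]

variable {d : ℕ}

theorem DepthGE.ext_eq_zero {A B D : Type} [AddCommGroup A] [Module R A] [AddCommGroup B]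
    [Module R B] [AddCommGroup D] [Module R D] {f : A →ₗ[R] B} {g : B →ₗ[R] D}
    (hf : Function.Injective f) (h : Function.Exact f g) (hg : Function.Surjective g)
    (hD : DepthGE R d D)
    {z : Abelian.Ext (ModuleCat.of R (R ⧸ maximalIdeal R)) (ModuleCat.of R A) d}
    (hz : z.comp (Abelian.Ext.mk₀ (ModuleCat.ofHom f)) (add_zero d) = 0) : z = 0 := by
  have hS := exactComplex_shortExact hf h hg
  obtain _ | d := d
  · obtain ⟨φ, rfl⟩ := (Abelian.Ext.mk₀_bijective _ _).2 z
    have := hS.mono_f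
    rw [Abelian.Ext.mk₀_comp_mk₀, Abelian.Ext.mk₀_eq_zero_iff] at hz
    rw [Limits.zero_of_comp_mono (exactComplex f g h).f hz, Abelian.Ext.mk₀_zero]
  · obtain ⟨y, rfl⟩ := Abelian.Ext.covariant_sequence_exact₁ _ hS z hz rfl
    rw [(hD d d.lt_succ_self).elim y 0, Abelian.Ext.zero_comp]

theorem ext_comp_eq_zero {n i : ℕ} {f : R →ₗ[R] (Fin n → R)}
    (hf : ∀ j, f 1 j ∈ maximalIdeal R)
    (x : Abelian.Ext (ModuleCat.of R (R ⧸ maximalIdeal R)) (ModuleCat.of R R) i) :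
    x.comp (Abelian.Ext.mk₀ (ModuleCat.ofHom f)) (add_zero i) = 0 := by
  classical
  have hsum : ModuleCat.ofHom f =
      ∑ j, f 1 j • ModuleCat.ofHom (LinearMap.toSpanSingleton R (Fin n → R) (Pi.single j 1)) := by
    refine ModuleCat.hom_ext (LinearMap.ext_ring ?_)
    rw [ModuleCat.hom_sum]
    funext l
    simp [Pi.single_apply]
  rw [hsum, Abelian.Ext.mk₀_sum, Abelian.Ext.comp_sum]
  refine Finset.sum_eq_zero fun j _ => ?_
  rw [Abelian.Ext.mk₀_smul, Abelian.Ext.comp_smul]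
  exact ext_smul_eq_zero _ (smul_residue_eq_zero (hf j))

/-- A module of depth at least `depth R` whose minimal first syzygy is free is itself free. -/
theorem ker_eq_bot_of_free {n : ℕ} {p : (Fin n → R) →ₗ[R] X} (hp : Function.Surjective p)
    (hm : ∀ v ∈ LinearMap.ker p, ∀ i, v i ∈ maximalIdeal R) (hX : DepthGE R d X)
    (hR : ¬ ExtVanish R d (R ⧸ maximalIdeal R) R) [Module.Free R (LinearMap.ker p)] :
    LinearMap.ker p = ⊥ := by
  by_contra hne
  have := Submodule.nontrivial_iff_ne_bot.2 hne
  let b := Module.Free.chooseBasis R (LinearMap.ker p)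
  obtain ⟨j⟩ := b.index_nonempty
  let s : R →ₗ[R] LinearMap.ker p := LinearMap.toSpanSingleton R _ (b j)
  have hrs : b.coord j ∘ₗ s = LinearMap.id := LinearMap.ext_ring (by simp [s])
  refine hR (subsingleton_of_forall_eq 0 fun x => ?_)
  have hx : x.comp (Abelian.Ext.mk₀ (ModuleCat.ofHom s)) (add_zero d) = 0 := by
    refine hX.ext_eq_zero Subtype.val_injective (LinearMap.exact_subtype_ker_map p) hp ?_
    rw [Abelian.Ext.comp_assoc_of_second_deg_zero, Abelian.Ext.mk₀_comp_mk₀,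
      ← ModuleCat.ofHom_comp]
    exact ext_comp_eq_zero (hm _ (s 1).2) x
  rw [← x.comp_mk₀_id, ← ModuleCat.ofHom_id, ← hrs, ModuleCat.ofHom_comp,
    ← Abelian.Ext.mk₀_comp_mk₀, ← Abelian.Ext.comp_assoc_of_second_deg_zero, hx,
    Abelian.Ext.zero_comp]

/-- Over a ring of depth `d`, a finite module `X` of depth at least `d` such that `Tor_1(L, X) = 0`
for all finite `L` of depth at least `e`, where `e ≤ d`, is free. -/
theorem free_of_torOneVanish [IsNoetherianRing R] (hR : DepthGE R d R)
    (hR' : ¬ ExtVanish R d (R ⧸ maximalIdeal R) R) (e : ℕ) (he : e ≤ d) (X : Type)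
    [AddCommGroup X] [Module R X] [Module.Finite R X] (hX : DepthGE R d X)
    (h : ∀ (L : Type) [AddCommGroup L] [Module R L] [Module.Finite R L], DepthGE R e L →
      TorOneVanish R L X) : Module.Free R X := by
  induction e generalizing X with
  | zero => exact free_of_torOneVanish_residue (h _ DepthGE.zero)
  | succ e ih =>
    obtain ⟨n, p, hp, hm⟩ := exists_minimal_presentation R X
    have hker (k m : ℕ) (hk : k < d) (L : Type) [AddCommGroup L] [Module R L]
        {g : (Fin m → R) →ₗ[R] L} (hg : Function.Surjective g) (hL : DepthGE R k L) :
        DepthGE R (k + 1) (LinearMap.ker g) :=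
      DepthGE.left Subtype.val_injective (LinearMap.exact_subtype_ker_map g) hg
        ((depthGE_pi hR m).mono hk) hL
    have hdep : DepthGE R d (LinearMap.ker p) := by
      have := hker (d - 1) n (by omega) X hp (hX.mono (by omega))
      rwa [Nat.sub_add_cancel (by omega)] at this
    have : Module.Free R (LinearMap.ker p) := ih (by omega) _ hdep fun L _ _ _ hL => by
      obtain ⟨m, g, hg⟩ := Module.Finite.exists_fin' R L
      exact TorOneVanish.shift hg hp (h _ (hker e m (by omega) L hg hL))
    have hbij : Function.Bijective p :=
      ⟨LinearMap.ker_eq_bot.1 (ker_eq_bot_of_free hp hm hX hR'), hp⟩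
    exact Module.Free.of_equiv (LinearEquiv.ofBijective p hbij)

end Freeness

section Endomorphisms

open TensorProduct IsLocalRing

variable {R : Type} [CommRing R] {N : Type} [AddCommGroup N] [Module R N]
  {d : ℕ}

theorem exists_dual_id_eq_one [IsLocalRing R] [Module.Finite R N] [Nontrivial N]
    [Module.Free R (N →ₗ[R] N)] :
    ∃ φ : (N →ₗ[R] N) →ₗ[R] R, φ LinearMap.id = 1 := by
  let b := Module.Free.chooseBasis R (N →ₗ[R] N)
  by_cases h : ∃ i, b.repr LinearMap.id i ∉ maximalIdeal R
  · obtain ⟨i, hi⟩ := h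
    obtain ⟨u, hu⟩ := (notMem_maximalIdeal.1 hi).exists_left_inv
    exact ⟨u • b.coord i, hu⟩
  · push Not at h
    have hle : (⊤ : Submodule R N) ≤ maximalIdeal R • ⊤ := by
      intro x _
      have hx := LinearMap.congr_fun (b.linearCombination_repr LinearMap.id) x
      rw [LinearMap.id_apply, Finsupp.linearCombination_apply, Finsupp.sum,
        LinearMap.sum_apply] at hx
      rw [← hx]
      exact Submodule.sum_mem _ fun i _ => Submodule.smul_mem_smul (h i) Submodule.mem_top
    exact absurd (Submodule.eq_bot_of_le_smul_of_le_jacobson_bot _ _ Module.Finite.fg_top hle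
      (maximalIdeal_le_jacobson _)) top_ne_bot

theorem free_end [IsLocalRing R] [IsNoetherianRing R] [Module.Finite R N]
    (hR : DepthGE R d R)
    (hR' : ¬ ExtVanish R d (R ⧸ maximalIdeal R) R) (hN : AcyclicOnDepthGE R d N)
    (hNd : DepthGE R d N) : Module.Free R (N →ₗ[R] N) := by
  refine free_of_torOneVanish hR hR' d le_rfl _
    (hNd.hom fun i hi _ => hN N hNd i hi) fun L _ _ _ hL => ?_
  obtain ⟨n, g, hg⟩ := Module.Finite.exists_fin' R L
  exact .of_rTensor_injective (LinearMap.exact_subtype_ker_map g) hg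
    (rTensor_ker_subtype_injective hNd hN hg (hN L hL))

theorem exists_retract_of_dual_id_eq_one {C M : Type} [AddCommGroup C] [Module R C]
    [AddCommGroup M] [Module R M]
    {φ : (C ⊗[R] (M →ₗ[R] M) →ₗ[R] C ⊗[R] (M →ₗ[R] M)) →ₗ[R] R} (hφ : φ LinearMap.id = 1) :
    ∃ (s : C →ₗ[R] C ⊗[R] (M →ₗ[R] M)) (r : C ⊗[R] (M →ₗ[R] M) →ₗ[R] C),
      r ∘ₗ s = LinearMap.id := by
  let g : (M →ₗ[R] M) →ₗ[R] R := φ ∘ₗ LinearMap.lTensorHom C ∘ₗ LinearMap.llcomp R M M M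
  have hg : g LinearMap.id = 1 := by
    rw [← hφ, ← LinearMap.lTensor_id]
    rfl
  refine ⟨(TensorProduct.mk R C _).flip LinearMap.id,
    (TensorProduct.rid R C).toLinearMap ∘ₗ g.lTensor C, LinearMap.ext fun c => ?_⟩
  change TensorProduct.rid R C (c ⊗ₜ g LinearMap.id) = c
  rw [hg, TensorProduct.rid_tmul, one_smul]

theorem HasFiniteInjDim.of_retract {A B : Type} [AddCommGroup A] [Module R A] [AddCommGroup B]
    [Module R B] (h : HasFiniteInjDim R B) (s : A →ₗ[R] B) (r : B →ₗ[R] A)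
    (hrs : r ∘ₗ s = LinearMap.id) : HasFiniteInjDim R A := by
  obtain ⟨n, hn⟩ := h
  refine ⟨n, fun L _ _ i hi => (subsingleton_extMod_iff i).2 ?_⟩
  exact ((subsingleton_extMod_iff i).1 (hn L i hi)).of_retract_right s r hrs

end Endomorphisms

section ModuleDepth

open IsLocalRing

variable {R : Type} [CommRing R] [IsLocalRing R] {A : Type} [AddCommGroup A] [Module R A] {d : ℕ}

theorem depthGE_moduleDepth : DepthGE R (moduleDepth R A) A :=
  fun i hi => (subsingleton_extMod_iff i).1 (not_not.1 (Nat.notMem_of_lt_sInf hi))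

theorem moduleDepth_eq (h : DepthGE R d A) (h' : ¬ ExtVanish R d (R ⧸ maximalIdeal R) A) :
    moduleDepth R A = d := by
  refine le_antisymm (Nat.sInf_le fun hs => h' ((subsingleton_extMod_iff d).1 hs)) ?_
  refine not_lt.1 fun hlt => ?_
  have hne : {i : ℕ | ¬ Subsingleton (extMod R i (R ⧸ maximalIdeal R) A)}.Nonempty :=
    ⟨d, fun hs => h' ((subsingleton_extMod_iff d).1 hs)⟩
  exact Nat.sInf_mem hne ((subsingleton_extMod_iff _).2 (h _ hlt))

end ModuleDepth

section Semidualizing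

variable {R : Type} [CommRing R] {C : Type} [AddCommGroup C] [Module R C]

theorem IsSemidualizing.nontrivial [Nontrivial R] (hC : IsSemidualizing R C) : Nontrivial C := by
  refine not_subsingleton_iff_nontrivial.1 fun _ => zero_ne_one (α := R) (hC.bijective.1 ?_)
  exact LinearMap.ext fun _ => Subsingleton.elim _ _

theorem IsSemidualizing.extVanish (hC : IsSemidualizing R C) (i : ℕ) (hi : 1 ≤ i) :
    ExtVanish R i C C :=
  (subsingleton_extMod_iff i).1 (hC.ext_vanish i hi)

theorem IsSemidualizing.depthGE [IsLocalRing R] [IsNoetherianRing R] [Module.Finite R C]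
    (hC : IsSemidualizing R C) {n : ℕ} (hR : DepthGE R n R) : DepthGE R n C :=
  have := hC.nontrivial
  .of_hom hC.extVanish (hR.congr (LinearEquiv.ofBijective _ hC.bijective).symm)

end Semidualizing

theorem cm_and_canonical_of_mcm_endo
    (R : Type) [CommRing R] [IsNoetherianRing R] [IsLocalRing R]
    (d : ℕ) (hd : ringKrullDim R = d)
    (C : Type) [AddCommGroup C] [Module R C] [Module.Finite R C]
    (hC : IsSemidualizing R C)
    (M : Type) [AddCommGroup M] [Module R M] [Module.Finite R M] [Nontrivial M]
    (hMmcm : moduleDepth R M = d)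
    (hCinj : HasFiniteInjDim R (TensorProduct R C (M →ₗ[R] M)))
    (hextM : ∀ i : ℕ, 1 ≤ i → i ≤ d - 1 → Subsingleton (extMod R i M M)) :
    moduleDepth R R = d ∧ HasFiniteInjDim R C := by
  have hM : DepthGE R d M := hMmcm ▸ depthGE_moduleDepth
  have hH : DepthGE R d (M →ₗ[R] M) :=
    hM.hom fun i hi hid => (subsingleton_extMod_iff i).1 (hextM i hi (by omega))
  have := hC.nontrivial
  have : Nontrivial (M →ₗ[R] M) := inferInstanceAs (Nontrivial (Module.End R M))
  have hN0 : Nontrivial (TensorProduct R C (M →ₗ[R] M)) := by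
    rw [← not_subsingleton_iff_nontrivial]
    exact fun h => not_subsingleton _ (subsingleton_of_subsingleton_tensorProduct h)
  obtain ⟨t, htd, ht, ht'⟩ := exists_depthGE_and_not_extVanish hd
  have hN : InjDimLE R t (TensorProduct R C (M →ₗ[R] M)) := by
    obtain ⟨n, hn⟩ := hCinj
    exact InjDimLE.le_depth ht ht' fun L _ _ _ i hi => (subsingleton_extMod_iff i).1 (hn L i hi)
  obtain rfl : t = d := by
    refine htd.eq_of_not_lt fun hlt => not_subsingleton (TensorProduct R C (M →ₗ[R] M)) ?_
    have h0 := extVanish_zero_iff.1 (hH.extVanish hN (i := 0) (by omega))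
    refine subsingleton_of_forall_eq 0 fun z => ?_
    refine LinearMap.congr_fun (TensorProduct.ext' (g := LinearMap.id) (h := 0) fun c f => ?_) z
    exact LinearMap.congr_fun (Subsingleton.elim (TensorProduct.mk R C (M →ₗ[R] M) c) 0) f
  refine ⟨moduleDepth_eq ht ht', ?_⟩
  have hCd := hC.depthGE ht
  have hacyc := hN.acyclicOnDepthGE
  have hη := mk_flip_bijective hC.bijective hC.extVanish hCd hacyc
  have hNd : DepthGE R t (TensorProduct R C (M →ₗ[R] M)) :=
    .of_hom (hacyc C hCd) (hH.congr (LinearEquiv.ofBijective _ hη).symm)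
  have := free_end ht ht' hacyc hNd
  obtain ⟨φ, hφ⟩ := exists_dual_id_eq_one (R := R) (N := TensorProduct R C (M →ₗ[R] M))
  obtain ⟨s, r, hrs⟩ := exists_retract_of_dual_id_eq_one hφ
  exact hCinj.of_retract s r hrs
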